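/- Let (X_i)_{i≥1} be a stationary ergodic sequence taking values in ℝ^d with marginal distribution F, and let A, B be Borel subsets of ℝ^d. Then E| (1/binom(n,2)) ∑_{1≤i<j≤n} 1_A(X_i) 1_B(X_j) − P(X_1 ∈ A) P(X_1 ∈ B) | → 0 as n → ∞. -/

import Mathlib

open MeasureTheory Filter Topology

lemma aux_mean_ergodic {Y : Type*} [MeasurableSpace Y] (ν : Measure Y) [IsProbabilityMeasure ν]
    (T : Y → Y) (hT : Ergodic T ν) (f : Y → ℝ) (hf : MemLp f 2 ν) :
    Tendsto (fun n : ℕ => ∫ y, |(n : ℝ)⁻¹ * (∑ k ∈ Finset.range n, f (T^[k] y)) - ∫ z, f z ∂ν| ∂ν)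
      atTop (𝓝 0) := by
  have hmp := hT.toMeasurePreserving
  let U := (Lp.compMeasurePreservingₗᵢ (E := ℝ) (p := 2) ℝ T hmp).toContinuousLinearMap
  have hU : ∀ g : Lp ℝ 2 ν, U g = Lp.compMeasurePreserving T hmp g := fun g => rfl
  have hU1 : ‖U‖ ≤ 1 := LinearIsometry.norm_toContinuousLinearMap_le _
  have hlim := ContinuousLinearMap.tendsto_birkhoffAverage_orthogonalProjection U hU1 (hf.toLp f)
  set P : Lp ℝ 2 ν := ((U.eqLocus (1 : Lp ℝ 2 ν →L[ℝ] Lp ℝ 2 ν)).orthogonalProjectionOnto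
    (hf.toLp f) : Lp ℝ 2 ν) with hP
  have hPfix : U P = P := by
    have := ((U.eqLocus (1 : Lp ℝ 2 ν →L[ℝ] Lp ℝ 2 ν)).orthogonalProjectionOnto
      (hf.toLp f)).2
    exact this
  have hc : ∃ c, (P : Y → ℝ) =ᵐ[ν] Function.const Y c := by
    apply hT.ae_eq_const_of_ae_eq_comp_ae (Lp.aestronglyMeasurable P)
    have h1 := Lp.coeFn_compMeasurePreserving P hmp
    rw [← hU, hPfix] at h1
    exact h1.symm
  obtain ⟨c, hc⟩ := hc
  have hiter : ∀ k, ((U^[k] (hf.toLp f) : Lp ℝ 2 ν) : Y → ℝ) =ᵐ[ν] fun y => f (T^[k] y) := by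
    intro k
    have h1 : U^[k] (hf.toLp f) =
        Lp.compMeasurePreserving T^[k] (hmp.iterate k) (hf.toLp f) :=
      congrFun (Lp.compMeasurePreserving_iterate (E := ℝ) (p := 2) hmp k) (hf.toLp f)
    rw [h1, Lp.toLp_compMeasurePreserving]
    exact MemLp.coeFn_toLp _
  have hsum : ∀ n, ((birkhoffSum U _root_.id n (hf.toLp f) : Lp ℝ 2 ν) : Y → ℝ) =ᵐ[ν]
      fun y => ∑ k ∈ Finset.range n, f (T^[k] y) := by
    intro n
    induction n with
    | zero =>
      filter_upwards [Lp.coeFn_zero ℝ 2 ν] with y hy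
      simpa using hy
    | succ n ih =>
      rw [birkhoffSum_succ]
      filter_upwards [Lp.coeFn_add (birkhoffSum U _root_.id n (hf.toLp f)) (U^[n] (hf.toLp f)),
        ih, hiter n] with y h1 h2 h3
      rw [Finset.sum_range_succ, ← h2, ← h3]
      exact h1
  have havg : ∀ n, ((birkhoffAverage ℝ U _root_.id n (hf.toLp f) - P : Lp ℝ 2 ν) : Y → ℝ) =ᵐ[ν]
      fun y => (n : ℝ)⁻¹ * (∑ k ∈ Finset.range n, f (T^[k] y)) - c := by
    intro n
    filter_upwards [Lp.coeFn_sub (birkhoffAverage ℝ U _root_.id n (hf.toLp f)) P, hsum n, hc,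
      Lp.coeFn_smul (n : ℝ)⁻¹ (birkhoffSum U _root_.id n (hf.toLp f))] with y h1 h2 h3 h4
    rw [h1, Pi.sub_apply, h3, birkhoffAverage, h4, Pi.smul_apply, h2]
    simp
  have hL1 : Tendsto (fun n : ℕ => ∫ y,
      |(n : ℝ)⁻¹ * (∑ k ∈ Finset.range n, f (T^[k] y)) - c| ∂ν) atTop (𝓝 0) := by
    have h0 : Tendsto (fun n => ‖birkhoffAverage ℝ U _root_.id n (hf.toLp f) - P‖) atTop (𝓝 0) :=
      tendsto_iff_norm_sub_tendsto_zero.1 hlim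
    refine squeeze_zero (fun n => integral_nonneg fun y => abs_nonneg _) (fun n => ?_) h0
    set G := birkhoffAverage ℝ U _root_.id n (hf.toLp f) - P
    have h1 : ∫ y, |(n : ℝ)⁻¹ * (∑ k ∈ Finset.range n, f (T^[k] y)) - c| ∂ν = ∫ y, ‖G y‖ ∂ν := by
      apply integral_congr_ae
      filter_upwards [havg n] with y hy
      rw [hy, Real.norm_eq_abs]
    rw [h1, integral_norm_eq_lintegral_enorm (Lp.aestronglyMeasurable G), Lp.norm_def,
      ← eLpNorm_one_eq_lintegral_enorm]
    exact ENNReal.toReal_mono (Lp.eLpNorm_ne_top G)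
      (eLpNorm_le_eLpNorm_of_exponent_le (by norm_num) (Lp.aestronglyMeasurable G))
  have hfi : Integrable f ν := hf.integrable (by norm_num)
  have hfk : ∀ k, Integrable (fun y => f (T^[k] y)) ν := fun k =>
    (hmp.iterate k).integrable_comp_of_integrable hfi
  have hik : ∀ k, ∫ y, f (T^[k] y) ∂ν = ∫ y, f y ∂ν := by
    intro k
    have h := hmp.iterate k
    conv_rhs => rw [← h.map_eq]
    rw [integral_map h.measurable.aemeasurable]
    rw [h.map_eq]; exact hfi.aestronglyMeasurable
  have hceq : ∫ z, f z ∂ν = c := by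
    have h2 : Tendsto (fun _ : ℕ => |∫ z, f z ∂ν - c|) atTop (𝓝 0) := by
      refine squeeze_zero' (Eventually.of_forall fun n => abs_nonneg _) ?_ hL1
      filter_upwards [eventually_gt_atTop 0] with n hn
      have hn' : (n : ℝ) ≠ 0 := by positivity
      have hs : Integrable (fun y => ∑ k ∈ Finset.range n, f (T^[k] y)) ν :=
        integrable_finsetSum _ fun k _ => hfk k
      have : ∫ y, ((n : ℝ)⁻¹ * (∑ k ∈ Finset.range n, f (T^[k] y)) - c) ∂ν = ∫ z, f z ∂ν - c := by
        rw [integral_sub (hs.const_mul _) (integrable_const c), integral_const_mul,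
          integral_finsetSum _ fun k _ => hfk k]
        simp [hik, hn']
      rw [← this]
      exact abs_integral_le_integral_abs
    have := tendsto_nhds_unique h2 tendsto_const_nhds
    exact sub_eq_zero.1 (abs_eq_zero.1 this.symm)
  rw [hceq]; exact hL1

lemma aux_weighted (c : ℕ → ℝ) (n : ℕ) :
    ∑ j ∈ Finset.range n, (j : ℝ) * c j =
      (n + 1 : ℝ) * (∑ j ∈ Finset.range n, c j)
        - (∑ j ∈ Finset.range n, c j)
        - ∑ k ∈ Finset.range n, ∑ j ∈ Finset.range (k + 1), c j := by
  induction n with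
  | zero => simp
  | succ n ih =>
    rw [Finset.sum_range_succ, ih, Finset.sum_range_succ (fun k => ∑ j ∈ Finset.range (k + 1), c j),
      Finset.sum_range_succ c]
    push_cast; ring

lemma aux_cesaro (D : ℕ → ℝ) (hD0 : ∀ n, 0 ≤ D n)
    (hD : Tendsto (fun n : ℕ => (n : ℝ)⁻¹ * D n) atTop (𝓝 0)) (hz : D 0 = 0) :
    Tendsto (fun n : ℕ => ((n : ℝ) ^ 2)⁻¹ * ∑ j ∈ Finset.range n, D j) atTop (𝓝 0) := by
  refine squeeze_zero (fun n => mul_nonneg (by positivity) (Finset.sum_nonneg fun j _ => hD0 j))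
    (fun n => ?_) hD.cesaro
  rcases Nat.eq_zero_or_pos n with rfl | hn
  · simp
  have hn' : (0 : ℝ) < n := by exact_mod_cast hn
  have : ∑ j ∈ Finset.range n, D j ≤ n * ∑ j ∈ Finset.range n, (j : ℝ)⁻¹ * D j := by
    rw [Finset.mul_sum]
    refine Finset.sum_le_sum fun j hj => ?_
    rcases Nat.eq_zero_or_pos j with rfl | hj0
    · simp [hz]
    have hj' : (0 : ℝ) < j := by exact_mod_cast hj0
    have hjn : (j : ℝ) ≤ n := by exact_mod_cast (Finset.mem_range.1 hj).le
    have h1 : 0 ≤ (j : ℝ)⁻¹ * D j := mul_nonneg (by positivity) (hD0 j)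
    calc D j = j * ((j : ℝ)⁻¹ * D j) := by field_simp
      _ ≤ _ := mul_le_mul_of_nonneg_right hjn h1
  calc ((n : ℝ) ^ 2)⁻¹ * ∑ j ∈ Finset.range n, D j
      ≤ ((n : ℝ) ^ 2)⁻¹ * (n * ∑ j ∈ Finset.range n, (j : ℝ)⁻¹ * D j) := by gcongr
    _ = _ := by field_simp

lemma aux_sum_id (n : ℕ) : ∑ j ∈ Finset.range n, (j : ℝ) = (n.choose 2 : ℝ) := by
  rw [Nat.cast_choose_two]
  induction n with
  | zero => simp
  | succ n ih => rw [Finset.sum_range_succ, ih]; push_cast; ring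

lemma aux_pointwise (a b : ℕ → ℝ) (hb : ∀ k, |b k| ≤ 1) (p q : ℝ) (hp : |p| ≤ 1) (n : ℕ) :
    |(∑ j ∈ Finset.range n, ∑ i ∈ Finset.range j, a i * b j) - n.choose 2 * (p * q)| ≤
      (∑ j ∈ Finset.range n, |∑ i ∈ Finset.range j, a i - j * p|) +
      (n * |∑ i ∈ Finset.range n, b i - n * q| +
        ∑ k ∈ Finset.range n, |∑ i ∈ Finset.range (k + 1), b i - (k + 1 : ℕ) * q|) := by
  have e : ∀ m, ∑ j ∈ Finset.range m, (b j - q) = ∑ j ∈ Finset.range m, b j - m * q := by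
    intro m; simp [Finset.sum_sub_distrib]
  have h0 : (∑ j ∈ Finset.range n, ∑ i ∈ Finset.range j, a i * b j) - n.choose 2 * (p * q) =
      (∑ j ∈ Finset.range n, (∑ i ∈ Finset.range j, a i - j * p) * b j) +
        p * ∑ j ∈ Finset.range n, (j : ℝ) * (b j - q) := by
    rw [← aux_sum_id, Finset.sum_mul, Finset.mul_sum, ← Finset.sum_sub_distrib,
      ← Finset.sum_add_distrib]
    refine Finset.sum_congr rfl fun j _ => ?_
    rw [← Finset.sum_mul]; ring
  rw [h0]
  refine (abs_add_le _ _).trans (add_le_add ?_ ?_)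
  · refine (Finset.abs_sum_le_sum_abs _ _).trans (Finset.sum_le_sum fun j _ => ?_)
    rw [abs_mul]
    exact mul_le_of_le_one_right (abs_nonneg _) (hb j)
  · rw [abs_mul]
    refine (mul_le_of_le_one_left (abs_nonneg _) hp).trans ?_
    rw [aux_weighted (fun j => b j - q)]
    simp only [e]
    have : ((n : ℝ) + 1) * (∑ j ∈ Finset.range n, b j - n * q)
        - (∑ j ∈ Finset.range n, b j - n * q)
        - ∑ k ∈ Finset.range n, (∑ j ∈ Finset.range (k + 1), b j - (k + 1 : ℕ) * q) =
        n * (∑ j ∈ Finset.range n, b j - n * q) -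
        ∑ k ∈ Finset.range n, (∑ j ∈ Finset.range (k + 1), b j - (k + 1 : ℕ) * q) := by ring
    rw [this]
    refine (abs_sub _ _).trans (add_le_add ?_ (Finset.abs_sum_le_sum_abs _ _))
    rw [abs_mul, Nat.abs_cast]

lemma aux_comb {Ω : Type*} [MeasurableSpace Ω] (μ : Measure Ω) [IsProbabilityMeasure μ]
    (a b : ℕ → Ω → ℝ) (ha : ∀ k, Integrable (a k) μ) (hb : ∀ k, Integrable (b k) μ)
    (hb1 : ∀ k ω, |b k ω| ≤ 1) (p q : ℝ) (hp : |p| ≤ 1)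
    (hap : Tendsto (fun n : ℕ => ∫ ω, |(n : ℝ)⁻¹ * (∑ k ∈ Finset.range n, a k ω) - p| ∂μ)
      atTop (𝓝 0))
    (hbq : Tendsto (fun n : ℕ => ∫ ω, |(n : ℝ)⁻¹ * (∑ k ∈ Finset.range n, b k ω) - q| ∂μ)
      atTop (𝓝 0)) :
    Tendsto (fun n : ℕ => ∫ ω, |(n.choose 2 : ℝ)⁻¹ *
      (∑ j ∈ Finset.range n, ∑ i ∈ Finset.range j, a i ω * b j ω) - p * q| ∂μ) atTop (𝓝 0) := by
  -- L¹ errors of the partial sums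
  have key : ∀ (c : ℕ → Ω → ℝ) (r : ℝ)
      (_ : Tendsto (fun n : ℕ => ∫ ω, |(n : ℝ)⁻¹ * (∑ k ∈ Finset.range n, c k ω) - r| ∂μ)
        atTop (𝓝 0)),
      Tendsto (fun n : ℕ => (n : ℝ)⁻¹ * ∫ ω, |∑ k ∈ Finset.range n, c k ω - n * r| ∂μ)
        atTop (𝓝 0) := by
    intro c r h
    refine h.congr' ?_
    filter_upwards [eventually_gt_atTop 0] with n hn
    have hn' : (0 : ℝ) < n := by exact_mod_cast hn
    rw [← integral_const_mul]
    congr 1; ext ω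
    rw [← abs_of_pos (inv_pos.2 hn'), ← abs_mul, abs_of_pos (inv_pos.2 hn'), mul_sub,
      inv_mul_cancel_left₀ hn'.ne']
  have hI : ∀ (c : ℕ → Ω → ℝ) (r : ℝ) (_ : ∀ k, Integrable (c k) μ) (n : ℕ),
      Integrable (fun ω => |∑ k ∈ Finset.range n, c k ω - n * r|) μ := by
    intro c r h n
    exact ((integrable_finsetSum _ fun k _ => h k).sub (integrable_const _)).abs
  set D : ℕ → ℝ := fun n => ∫ ω, |∑ k ∈ Finset.range n, a k ω - n * p| ∂μ with hD
  set G : ℕ → ℝ := fun n => ∫ ω, |∑ k ∈ Finset.range n, b k ω - n * q| ∂μ with hG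
  have hD0 : ∀ n, 0 ≤ D n := fun n => integral_nonneg fun _ => abs_nonneg _
  have hG0 : ∀ n, 0 ≤ G n := fun n => integral_nonneg fun _ => abs_nonneg _
  have hDz : D 0 = 0 := by simp [hD]
  have hGz : G 0 = 0 := by simp [hG]
  have hDt := key a p hap
  have hGt := key b q hbq
  have hDc := aux_cesaro D hD0 hDt hDz
  have hGc := aux_cesaro G hG0 hGt hGz
  have hlim : Tendsto (fun n : ℕ => 4 * (((n : ℝ) ^ 2)⁻¹ * (∑ j ∈ Finset.range n, D j) +
      (2 * ((n : ℝ)⁻¹ * G n) + ((n : ℝ) ^ 2)⁻¹ * (∑ j ∈ Finset.range n, G j)))) atTop (𝓝 0) := by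
    simpa using (hDc.add ((hGt.const_mul 2).add hGc)).const_mul 4
  refine squeeze_zero' (Eventually.of_forall fun n => integral_nonneg fun _ => abs_nonneg _) ?_ hlim
  filter_upwards [eventually_ge_atTop 2] with n hn
  have hn' : (2 : ℝ) ≤ n := by exact_mod_cast hn
  have hch : (n.choose 2 : ℝ) = n * (n - 1) / 2 := Nat.cast_choose_two ℝ n
  have hchpos : (0 : ℝ) < n.choose 2 := by
    rw [hch]; nlinarith
  have hchinv : (n.choose 2 : ℝ)⁻¹ ≤ 4 * ((n : ℝ) ^ 2)⁻¹ := by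
    have : (n : ℝ) ^ 2 / 4 ≤ n.choose 2 := by rw [hch]; nlinarith
    calc (n.choose 2 : ℝ)⁻¹ ≤ ((n : ℝ) ^ 2 / 4)⁻¹ := inv_anti₀ (by positivity) this
      _ = _ := by rw [inv_div]; ring
  have hIa : Integrable (fun ω => ∑ j ∈ Finset.range n,
      |∑ i ∈ Finset.range j, a i ω - j * p|) μ := integrable_finsetSum _ fun j _ => hI a p ha j
  have hIb : Integrable (fun ω => ∑ k ∈ Finset.range n,
      |∑ i ∈ Finset.range (k + 1), b i ω - (k + 1 : ℕ) * q|) μ :=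
    integrable_finsetSum _ fun k _ => hI b q hb (k + 1)
  have hIc : Integrable (fun ω => (n : ℝ) * |∑ i ∈ Finset.range n, b i ω - n * q|) μ :=
    (hI b q hb n).const_mul _
  have hpt : ∀ ω, |(n.choose 2 : ℝ)⁻¹ *
      (∑ j ∈ Finset.range n, ∑ i ∈ Finset.range j, a i ω * b j ω) - p * q| ≤
      (n.choose 2 : ℝ)⁻¹ * ((∑ j ∈ Finset.range n, |∑ i ∈ Finset.range j, a i ω - j * p|) +
      (n * |∑ i ∈ Finset.range n, b i ω - n * q| +
        ∑ k ∈ Finset.range n, |∑ i ∈ Finset.range (k + 1), b i ω - (k + 1 : ℕ) * q|)) := by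
    intro ω
    have h := aux_pointwise (fun k => a k ω) (fun k => b k ω) (fun k => hb1 k ω) p q hp n
    have h2 := mul_le_mul_of_nonneg_left h (inv_pos.2 hchpos).le
    refine le_of_eq_of_le ?_ h2
    rw [← abs_of_pos (inv_pos.2 hchpos), ← abs_mul, abs_of_pos (inv_pos.2 hchpos), mul_sub,
      inv_mul_cancel_left₀ hchpos.ne']
  have hint : ∫ ω, |(n.choose 2 : ℝ)⁻¹ *
      (∑ j ∈ Finset.range n, ∑ i ∈ Finset.range j, a i ω * b j ω) - p * q| ∂μ ≤
      (n.choose 2 : ℝ)⁻¹ * ((∑ j ∈ Finset.range n, D j) +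
        (n * G n + ∑ k ∈ Finset.range n, G (k + 1))) := by
    refine (integral_mono_of_nonneg (Eventually.of_forall fun _ => abs_nonneg _)
      ((hIa.add (hIc.add hIb)).const_mul (n.choose 2 : ℝ)⁻¹)
      (Eventually.of_forall hpt)).trans (le_of_eq ?_)
    rw [integral_const_mul]
    congr 1
    rw [integral_add' hIa (hIc.add hIb), integral_add' hIc hIb, integral_const_mul,
      integral_finsetSum _ fun j _ => hI a p ha j,
      integral_finsetSum _ fun k _ => hI b q hb (k + 1)]
  have hGs : ∑ k ∈ Finset.range n, G (k + 1) = ∑ k ∈ Finset.range n, G k + G n := by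
    have h1 := Finset.sum_range_succ' G n
    have h2 := Finset.sum_range_succ G n
    linarith
  have hDs : 0 ≤ ∑ j ∈ Finset.range n, D j := Finset.sum_nonneg fun j _ => hD0 j
  have hGs0 : 0 ≤ ∑ j ∈ Finset.range n, G j := Finset.sum_nonneg fun j _ => hG0 j
  have hGn := hG0 n
  calc _ ≤ _ := hint
    _ ≤ (4 * ((n : ℝ) ^ 2)⁻¹) * ((∑ j ∈ Finset.range n, D j) +
        (2 * n * G n + ∑ k ∈ Finset.range n, G k)) := by
        refine mul_le_mul hchinv ?_ ?_ (by positivity)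
        · rw [hGs]; nlinarith
        · have : 0 ≤ ∑ k ∈ Finset.range n, G (k + 1) := Finset.sum_nonneg fun j _ => hG0 _
          positivity
    _ = _ := by field_simp

lemma aux_path {Ω : Type*} [MeasurableSpace Ω] (μ : Measure Ω) [IsProbabilityMeasure μ]
    (d : ℕ) (X : ℕ → Ω → (Fin d → ℝ)) (hXmeas : ∀ k, Measurable (X k))
    (hX : Ergodic (fun u : ℕ → (Fin d → ℝ) => fun n => u (n + 1))
      (Measure.map (fun ω => fun n => X (n + 1) ω) μ))
    (A : Set (Fin d → ℝ)) (hA : MeasurableSet A) :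
    Tendsto (fun n : ℕ => ∫ ω, |(n : ℝ)⁻¹ * (∑ k ∈ Finset.range n,
      Set.indicator A (fun _ => (1 : ℝ)) (X (k + 1) ω)) - (μ (X 1 ⁻¹' A)).toReal| ∂μ)
      atTop (𝓝 0) := by
  have hφ : Measurable (fun ω => fun n => X (n + 1) ω) :=
    measurable_pi_lambda _ fun n => hXmeas (n + 1)
  have hprob : IsProbabilityMeasure (Measure.map (fun ω => fun n => X (n + 1) ω) μ) :=
    Measure.isProbabilityMeasure_map hφ.aemeasurable
  have hg : Measurable (Set.indicator A (fun _ => (1 : ℝ))) := measurable_const.indicator hA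
  have hfm : Measurable (fun u : ℕ → (Fin d → ℝ) => Set.indicator A (fun _ => (1 : ℝ)) (u 0)) :=
    hg.comp (measurable_pi_apply 0)
  have hf : MemLp (fun u : ℕ → (Fin d → ℝ) => Set.indicator A (fun _ => (1 : ℝ)) (u 0)) 2
      (Measure.map (fun ω => fun n => X (n + 1) ω) μ) := by
    refine MemLp.of_bound hfm.aestronglyMeasurable 1 (Eventually.of_forall fun u => ?_)
    by_cases h : u 0 ∈ A <;> simp [h]
  have h := aux_mean_ergodic _ _ hX _ hf
  have hit : ∀ (k : ℕ) (u : ℕ → (Fin d → ℝ)) (m : ℕ),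
      ((fun u : ℕ → (Fin d → ℝ) => fun n => u (n + 1))^[k] u) m = u (m + k) := by
    intro k
    induction k with
    | zero => simp
    | succ k ih =>
      intro u m
      rw [Function.iterate_succ_apply, ih]
      rfl
  have hE : ∫ z, Set.indicator A (fun _ => (1 : ℝ)) (z 0)
      ∂(Measure.map (fun ω => fun n => X (n + 1) ω) μ) = (μ (X 1 ⁻¹' A)).toReal := by
    rw [integral_map hφ.aemeasurable hfm.aestronglyMeasurable]
    have : (fun ω => Set.indicator A (fun _ => (1 : ℝ)) (X (0 + 1) ω)) =
        Set.indicator (X 1 ⁻¹' A) (fun _ => (1 : ℝ)) := by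
      ext ω; rfl
    rw [this, integral_indicator_const _ (hXmeas 1 hA)]
    simp [Measure.real]
  rw [hE] at h
  refine h.congr fun n => ?_
  rw [integral_map hφ.aemeasurable]
  · simp only [hit, Nat.zero_add]
  · simp only [hit, Nat.zero_add]
    have : Measurable (fun u : ℕ → (Fin d → ℝ) => (n : ℝ)⁻¹ * (∑ k ∈ Finset.range n,
        Set.indicator A (fun _ => (1 : ℝ)) (u k)) - (μ (X 1 ⁻¹' A)).toReal) :=
      ((Finset.measurable_fun_sum _ fun k _ =>
        hg.comp (measurable_pi_apply k)).const_mul _).sub_const _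
    exact this.norm.aestronglyMeasurable

/-- `L¹` convergence of the U-statistic with kernel `1_A(x) 1_B(y)` for a stationary
ergodic `ℝ^d`-valued sequence `(X_i)_{i ≥ 1}`. Stationarity and ergodicity are encoded by
requiring that the law of the path `(X_1, X_2, …)` is invariant and ergodic under the
one-sided shift. -/
theorem stmt3 {Ω : Type*} [MeasurableSpace Ω] (μ : Measure Ω) [IsProbabilityMeasure μ]
    (d : ℕ) (X : ℕ → Ω → (Fin d → ℝ)) (hXmeas : ∀ k, Measurable (X k))
    (hX : Ergodic (fun u : ℕ → (Fin d → ℝ) => fun n => u (n + 1))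
      (Measure.map (fun ω => fun n => X (n + 1) ω) μ))
    (A B : Set (Fin d → ℝ)) (hA : MeasurableSet A) (hB : MeasurableSet B) :
    Tendsto (fun n : ℕ => ∫ ω,
        |(n.choose 2 : ℝ)⁻¹ *
            (∑ j ∈ Finset.Icc 1 n, ∑ i ∈ Finset.Ico 1 j,
              Set.indicator A (fun _ => (1 : ℝ)) (X i ω) *
                Set.indicator B (fun _ => (1 : ℝ)) (X j ω))
          - (μ (X 1 ⁻¹' A)).toReal * (μ (X 1 ⁻¹' B)).toReal| ∂μ)
      atTop (𝓝 0) := by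
  have hre : ∀ (f g : ℕ → ℝ) (n : ℕ), ∑ j ∈ Finset.range n, ∑ i ∈ Finset.range j,
      f (i + 1) * g (j + 1) = ∑ j ∈ Finset.Icc 1 n, ∑ i ∈ Finset.Ico 1 j, f i * g j := by
    intro f g n
    induction n with
    | zero => simp
    | succ n ih =>
      rw [Finset.sum_range_succ, ih, Finset.sum_Icc_succ_top (by omega)]
      congr 1
      rw [Finset.sum_Ico_eq_sum_range]
      simp [add_comm]
  have hb1 : ∀ (S : Set (Fin d → ℝ)) x, |Set.indicator S (fun _ => (1 : ℝ)) x| ≤ 1 := by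
    intro S x
    by_cases h : x ∈ S <;> simp [h]
  have hint : ∀ (S : Set (Fin d → ℝ)) (_ : MeasurableSet S) (k : ℕ),
      Integrable (fun ω => Set.indicator S (fun _ => (1 : ℝ)) (X k ω)) μ := by
    intro S hS k
    exact Integrable.of_bound
      ((measurable_const.indicator hS).comp (hXmeas k)).aestronglyMeasurable 1
      (Eventually.of_forall fun ω => hb1 S _)
  have hp : |(μ (X 1 ⁻¹' A)).toReal| ≤ 1 := by
    rw [abs_of_nonneg ENNReal.toReal_nonneg]
    exact measureReal_le_one
  refine (aux_comb μ _ _ (fun k => hint A hA (k + 1)) (fun k => hint B hB (k + 1))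
    (fun k ω => hb1 B _) _ _ hp (aux_path μ d X hXmeas hX A hA)
    (aux_path μ d X hXmeas hX B hB)).congr fun n => ?_
  congr 1; ext ω
  rw [← hre (fun i => Set.indicator A (fun _ => (1 : ℝ)) (X i ω))
    (fun j => Set.indicator B (fun _ => (1 : ℝ)) (X j ω))]
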